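/- arXiv:1503.02190 — 3 statements merged into one kernel-verified Lean document; each statement's English description precedes it below -/
import Mathlib

section
/- Let Ω be an open subset of ℝ² and let p ∈ Ω. Then the smooth compactly supported functions on Ω \ {p} are dense in the smooth compactly supported functions on Ω with respect to the H¹ norm: for every smooth function u : ℝ² → ℝ whose support is compact and contained in Ω, and every ε > 0, there exists a smooth function v : ℝ² → ℝ whose support is compact and contained in Ω \ {p} such that ∫_{ℝ²} (‖∇u(x) − ∇v(x)‖² + (u(x) − v(x))²) dx < ε. -/
open MeasureTheory

noncomputable section

theorem norm_sum_sq_le_sum_norm_sq_of_pairwise {ι F : Type*} [SeminormedAddCommGroup F]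
    (s : Finset ι) (g : ι → F) (h : ∀ i ∈ s, ∀ j ∈ s, i ≠ j → g i = 0 ∨ g j = 0) :
    ‖∑ i ∈ s, g i‖ ^ 2 ≤ ∑ i ∈ s, ‖g i‖ ^ 2 := by
  by_cases hg : ∃ j ∈ s, g j ≠ 0
  · obtain ⟨j, hj, hgj⟩ := hg
    rw [Finset.sum_eq_single_of_mem j hj fun i hi hij => (h i hi j hj hij).resolve_right hgj]
    exact Finset.single_le_sum (f := fun i => ‖g i‖ ^ 2) (fun i _ => sq_nonneg _) hj
  · push Not at hg
    rw [Finset.sum_eq_zero hg]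
    simpa using Finset.sum_nonneg fun i _ => sq_nonneg ‖g i‖

theorem integrable_sq_and_norm_fderiv_sq {E : Type*} [NormedAddCommGroup E] [NormedSpace ℝ E]
    [MeasurableSpace E] [BorelSpace E] (μ : Measure E) [IsFiniteMeasureOnCompacts μ]
    {χ : E → ℝ} (hχ : ContDiff ℝ (⊤ : ℕ∞) χ)
    (hc : HasCompactSupport χ) :
    Integrable (fun x => χ x ^ 2) μ ∧ Integrable (fun x => ‖fderiv ℝ χ x‖ ^ 2) μ := by
  have hd : Continuous (fderiv ℝ χ) := hχ.continuous_fderiv (by simp)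
  have hc₀ : HasCompactSupport fun x => χ x ^ 2 :=
    hc.mono fun x hx => by simpa using hx
  have hc₁ : HasCompactSupport fun x => ‖fderiv ℝ χ x‖ ^ 2 :=
    (hc.fderiv ℝ).mono fun x hx => by simpa using hx
  exact ⟨(hχ.continuous.pow 2).integrable_of_hasCompactSupport hc₀,
    (hd.norm.pow 2).integrable_of_hasCompactSupport hc₁⟩

section Cutoff

variable {E : Type*} [NormedAddCommGroup E] [InnerProductSpace ℝ E] [FiniteDimensional ℝ E]

theorem ContDiffBump.fderiv_eq_zero_of_norm_lt {φ : ContDiffBump (0 : E)} {y : E}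
    (hy : ‖y‖ < φ.rIn) : fderiv ℝ φ y = 0 := by
  have h : φ =ᶠ[nhds y] fun _ => (1 : ℝ) :=
    φ.eventuallyEq_one_of_mem_ball (by simpa using hy)
  rw [h.fderiv_eq, fderiv_fun_const]
  rfl

theorem ContDiffBump.fderiv_eq_zero_of_lt_norm {φ : ContDiffBump (0 : E)} {y : E}
    (hy : φ.rOut < ‖y‖) : fderiv ℝ φ y = 0 := by
  by_contra h
  have := support_fderiv_subset ℝ (f := φ) h
  rw [φ.tsupport_eq] at this
  simp only [Metric.mem_closedBall, dist_zero_right] at this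
  linarith

theorem fderiv_comp_four_pow_smul_eq_zero_or {φ : ContDiffBump (0 : E)} (hin : φ.rIn = 1)
    (hout : φ.rOut = 2) (x : E) {i j : ℕ} (hij : i < j) :
    fderiv ℝ φ ((4 : ℝ) ^ i • x) = 0 ∨ fderiv ℝ φ ((4 : ℝ) ^ j • x) = 0 := by
  by_cases h : ‖(4 : ℝ) ^ i • x‖ < 1
  · exact .inl (φ.fderiv_eq_zero_of_norm_lt (hin ▸ h))
  · refine .inr (φ.fderiv_eq_zero_of_lt_norm (hout ▸ ?_))
    have hpow : (4 : ℝ) ^ (i + 1) ≤ 4 ^ j := pow_le_pow_right₀ (by norm_num) hij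
    simp only [norm_smul, norm_pow, Real.norm_ofNat, not_lt] at h ⊢
    have := mul_le_mul_of_nonneg_right hpow (norm_nonneg x)
    rw [pow_succ] at this
    linarith

variable [MeasurableSpace E] [BorelSpace E] (μ : Measure E) [μ.IsAddHaarMeasure]

/-- Points have zero `H¹` capacity in dimension two: the average of `φ (4 ^ k • x)` over `k < N`
is a cutoff function whose `H¹` energy is `O(1 / N)`. -/
theorem exists_cutoff_integral_lt (hE : Module.finrank ℝ E = 2) {δ : ℝ} (hδ : 0 < δ) :
    ∃ χ : E → ℝ, ContDiff ℝ (⊤ : ℕ∞) χ ∧ HasCompactSupport χ ∧ (∀ᶠ x in nhds 0, χ x = 1) ∧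
      ∫ x, (χ x ^ 2 + ‖fderiv ℝ χ x‖ ^ 2) ∂μ < δ := by
  let φ : ContDiffBump (0 : E) := ⟨1, 2, one_pos, one_lt_two⟩
  have hφ : ContDiff ℝ (⊤ : ℕ∞) φ := φ.contDiff
  set C₀ := ∫ x, φ x ^ 2 ∂μ
  set C₁ := ∫ x, ‖fderiv ℝ φ x‖ ^ 2 ∂μ
  have hC₀ : 0 ≤ C₀ := integral_nonneg fun x => sq_nonneg _
  have hC₁ : 0 ≤ C₁ := integral_nonneg fun x => sq_nonneg _
  obtain ⟨N, hN⟩ := exists_nat_gt ((2 * C₀ + C₁) / δ)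
  have hN0 : (0 : ℝ) < N := lt_of_le_of_lt (by positivity) hN
  let ψ : ℕ → E → ℝ := fun k x => φ ((4 : ℝ) ^ k • x)
  have hψ (k : ℕ) : ContDiff ℝ (⊤ : ℕ∞) (ψ k) := hφ.comp (contDiff_id.const_smul _)
  have hψc (k : ℕ) : HasCompactSupport (ψ k) := φ.hasCompactSupport.comp_smul (by positivity)
  have hψd (k : ℕ) (x : E) : fderiv ℝ (ψ k) x = (4 : ℝ) ^ k • fderiv ℝ φ ((4 : ℝ) ^ k • x) :=
    fderiv_comp_smul _
  have hint₀ (k : ℕ) : ∫ x, ψ k x ^ 2 ∂μ = (1 / 16) ^ k * C₀ := by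
    have := Measure.integral_comp_smul μ (fun x => φ x ^ 2) ((4 : ℝ) ^ k)
    rw [hE, abs_of_nonneg (by positivity), smul_eq_mul] at this
    rw [this, ← pow_mul, mul_comm k 2, pow_mul, one_div, inv_pow]
    norm_num [C₀]
  have hint₁ (k : ℕ) : ∫ x, ‖fderiv ℝ (ψ k) x‖ ^ 2 ∂μ = C₁ := by
    have := Measure.integral_comp_smul μ (fun x => ‖fderiv ℝ φ x‖ ^ 2) ((4 : ℝ) ^ k)
    rw [hE, abs_of_nonneg (by positivity), smul_eq_mul] at this
    simp only [hψd, norm_smul, mul_pow, norm_pow, Real.norm_ofNat]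
    rw [integral_const_mul, this, ← mul_assoc, mul_inv_cancel₀ (by positivity), one_mul]
  let χ : E → ℝ := fun x => (N : ℝ)⁻¹ * ∑ k ∈ Finset.range N, ψ k x
  have hχd (x : E) : fderiv ℝ χ x = (N : ℝ)⁻¹ • ∑ k ∈ Finset.range N, fderiv ℝ (ψ k) x := by
    have hd (k : ℕ) : DifferentiableAt ℝ (ψ k) x := (hψ k).differentiable (by simp) x
    rw [fderiv_const_mul (DifferentiableAt.fun_sum fun k _ => hd k),
      fderiv_fun_sum fun k _ => hd k]
  have hpt₀ (x : E) : χ x ^ 2 ≤ (N : ℝ)⁻¹ * ∑ k ∈ Finset.range N, ψ k x ^ 2 := by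
    have := sq_sum_le_card_mul_sum_sq (s := Finset.range N) (f := fun k => ψ k x)
    rw [Finset.card_range] at this
    calc χ x ^ 2 = (N : ℝ)⁻¹ ^ 2 * (∑ k ∈ Finset.range N, ψ k x) ^ 2 := mul_pow _ _ _
      _ ≤ (N : ℝ)⁻¹ ^ 2 * (N * ∑ k ∈ Finset.range N, ψ k x ^ 2) := by gcongr
      _ = _ := by field_simp
  have hpt₁ (x : E) : ‖fderiv ℝ χ x‖ ^ 2 ≤
      (N : ℝ)⁻¹ ^ 2 * ∑ k ∈ Finset.range N, ‖fderiv ℝ (ψ k) x‖ ^ 2 := by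
    rw [hχd, norm_smul, mul_pow, norm_inv, Real.norm_natCast]
    gcongr
    refine norm_sum_sq_le_sum_norm_sq_of_pairwise _ _ fun i _ j _ hij => ?_
    simp only [hψd]
    rcases lt_or_gt_of_ne hij with h | h
    · exact (fderiv_comp_four_pow_smul_eq_zero_or (φ := φ) rfl rfl x h).imp
        (by simp [·]) (by simp [·])
    · exact (fderiv_comp_four_pow_smul_eq_zero_or (φ := φ) rfl rfl x h).symm.imp
        (by simp [·]) (by simp [·])
  have hI₀ := fun k => (integrable_sq_and_norm_fderiv_sq μ (hψ k) (hψc k)).1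
  have hI₁ := fun k => (integrable_sq_and_norm_fderiv_sq μ (hψ k) (hψc k)).2
  have hS₀ := (integrable_finsetSum (Finset.range N) fun k _ => hI₀ k).const_mul (N : ℝ)⁻¹
  have hS₁ := (integrable_finsetSum (Finset.range N) fun k _ => hI₁ k).const_mul ((N : ℝ)⁻¹ ^ 2)
  refine ⟨χ, contDiff_const.mul (ContDiff.sum fun k _ => hψ k), ?_, ?_, ?_⟩
  · refine HasCompactSupport.mul_left (f := fun _ => (N : ℝ)⁻¹) ?_
    have hsum : HasCompactSupport (∑ k ∈ Finset.range N, ψ k) :=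
      Finset.sum_induction _ HasCompactSupport (fun _ _ => .add) .zero fun k _ => hψc k
    simpa only [← Finset.sum_apply] using hsum
  · have hev (k : ℕ) : ∀ᶠ x in nhds 0, ψ k x = 1 := by
      have : Filter.Tendsto (fun x : E => (4 : ℝ) ^ k • x) (nhds 0) (nhds 0) := by
        simpa using (continuous_const_smul ((4 : ℝ) ^ k)).tendsto (0 : E)
      exact this.eventually φ.eventuallyEq_one
    filter_upwards [(Finset.range N).eventually_all.2 fun k _ => hev k] with x hx
    simp only [χ, Finset.sum_congr rfl hx]
    simp [hN0.ne']
  · calc ∫ x, (χ x ^ 2 + ‖fderiv ℝ χ x‖ ^ 2) ∂μ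
        ≤ ∫ x, ((N : ℝ)⁻¹ * ∑ k ∈ Finset.range N, ψ k x ^ 2 +
          (N : ℝ)⁻¹ ^ 2 * ∑ k ∈ Finset.range N, ‖fderiv ℝ (ψ k) x‖ ^ 2) ∂μ :=
        integral_mono_of_nonneg (.of_forall fun x => by positivity) (hS₀.add hS₁)
          (.of_forall fun x => add_le_add (hpt₀ x) (hpt₁ x))
      _ = (N : ℝ)⁻¹ * ((∑ k ∈ Finset.range N, (1 / 16 : ℝ) ^ k) * C₀ + C₁) := by
        rw [integral_add hS₀ hS₁, integral_const_mul, integral_const_mul,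
          integral_finsetSum _ fun k _ => hI₀ k, integral_finsetSum _ fun k _ => hI₁ k]
        simp only [hint₀, hint₁, ← Finset.sum_mul, Finset.sum_const, Finset.card_range,
          nsmul_eq_mul]
        field_simp
      _ ≤ (N : ℝ)⁻¹ * (2 * C₀ + C₁) := by
        gcongr
        rw [geom_sum_eq (by norm_num), div_le_iff_of_neg (by norm_num)]
        have : (0 : ℝ) ≤ (1 / 16) ^ N := by positivity
        linarith
      _ < δ := by
        rw [div_lt_iff₀ hδ] at hN
        rwa [inv_mul_lt_iff₀ hN0]

end Cutoff

/-- Density of smooth compactly supported functions on `Ω \ {p}` in those on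
`Ω`, with respect to the `H¹` norm (Euclidean-domain case of Theorem A.4 of the paper). -/
theorem smooth_compactly_supported_dense_complement_point
    (Ω : Set (EuclideanSpace ℝ (Fin 2))) (hΩ : IsOpen Ω)
    (p : EuclideanSpace ℝ (Fin 2)) (hp : p ∈ Ω)
    (u : EuclideanSpace ℝ (Fin 2) → ℝ)
    (hu : ContDiff ℝ (⊤ : ℕ∞) u) (hucs : HasCompactSupport u) (husupp : tsupport u ⊆ Ω)
    (ε : ℝ) (hε : 0 < ε) :
    ∃ v : EuclideanSpace ℝ (Fin 2) → ℝ,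
      ContDiff ℝ (⊤ : ℕ∞) v ∧ HasCompactSupport v ∧ tsupport v ⊆ Ω \ {p} ∧
      ∫ x, (‖gradient u x - gradient v x‖ ^ 2 + (u x - v x) ^ 2) < ε := by
  obtain ⟨A, hA⟩ := hu.continuous.bounded_above_of_compact_support hucs
  obtain ⟨B, hB⟩ := (hu.continuous_fderiv (by simp)).bounded_above_of_compact_support
    (hucs.fderiv ℝ)
  set K := 2 * A ^ 2 + 2 * B ^ 2
  have hK : 0 ≤ K := by positivity
  obtain ⟨χ, hχ, hχc, hχ1, hχi⟩ := exists_cutoff_integral_lt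
    (volume : Measure (EuclideanSpace ℝ (Fin 2))) (by simp) (δ := ε / (K + 1)) (by positivity)
  have hχp : ContDiff ℝ (⊤ : ℕ∞) fun x => χ (x - p) := hχ.comp (contDiff_id.sub contDiff_const)
  let v : EuclideanSpace ℝ (Fin 2) → ℝ := fun x => u x * (1 - χ (x - p))
  have hv : ContDiff ℝ (⊤ : ℕ∞) v := hu.mul (contDiff_const.sub hχp)
  refine ⟨v, hv, hucs.mul_right, fun x hx => ⟨husupp (tsupport_mul_subset_left hx), ?_⟩, ?_⟩
  · rintro rfl
    refine notMem_tsupport_iff_eventuallyEq.2 ?_ hx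
    have : Filter.Tendsto (fun y => y - x) (nhds x) (nhds 0) := by
      simpa using (continuous_sub_right x).tendsto x
    filter_upwards [this.eventually hχ1] with y hy
    simp [v, hy]
  have hgrad (x) : ‖gradient u x - gradient v x‖ =
      ‖u x • fderiv ℝ χ (x - p) + χ (x - p) • fderiv ℝ u x‖ := by
    have hsub : u - v = fun x => u x * χ (x - p) := by
      ext y
      simp only [v, Pi.sub_apply]
      ring
    rw [gradient, gradient, ← map_sub, LinearIsometryEquiv.norm_map,
      ← fderiv_sub (hu.differentiable (by simp) x) (hv.differentiable (by simp) x), hsub,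
      fderiv_fun_mul (hu.differentiable (by simp) x) (hχp.differentiable (by simp) x),
      fderiv_comp_sub]
  have hpt (x) : ‖gradient u x - gradient v x‖ ^ 2 + (u x - v x) ^ 2 ≤
      K * (χ (x - p) ^ 2 + ‖fderiv ℝ χ (x - p)‖ ^ 2) := by
    have hA2 : u x ^ 2 ≤ A ^ 2 := sq_le_sq.2 ((hA x).trans (le_abs_self A))
    have hB2 : ‖fderiv ℝ u x‖ ^ 2 ≤ B ^ 2 := by gcongr; exact hB x
    have huv : u x - v x = u x * χ (x - p) := by simp only [v]; ring
    have h1 := norm_add_le (u x • fderiv ℝ χ (x - p)) (χ (x - p) • fderiv ℝ u x)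
    have h2 : ‖gradient u x - gradient v x‖ ^ 2 ≤
        2 * (u x ^ 2 * ‖fderiv ℝ χ (x - p)‖ ^ 2 + χ (x - p) ^ 2 * ‖fderiv ℝ u x‖ ^ 2) := by
      calc ‖gradient u x - gradient v x‖ ^ 2
          ≤ (‖u x • fderiv ℝ χ (x - p)‖ + ‖χ (x - p) • fderiv ℝ u x‖) ^ 2 := by
            rw [hgrad]; gcongr
        _ ≤ 2 * (‖u x • fderiv ℝ χ (x - p)‖ ^ 2 + ‖χ (x - p) • fderiv ℝ u x‖ ^ 2) := add_sq_le
        _ = _ := by simp only [norm_smul, mul_pow, Real.norm_eq_abs, sq_abs]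
    rw [huv, mul_pow]
    have h3 := mul_le_mul_of_nonneg_right hA2 (sq_nonneg ‖fderiv ℝ χ (x - p)‖)
    have h4 := mul_le_mul_of_nonneg_left hB2 (sq_nonneg (χ (x - p)))
    have h5 := mul_le_mul_of_nonneg_right hA2 (sq_nonneg (χ (x - p)))
    have h6 : 0 ≤ A ^ 2 * χ (x - p) ^ 2 := by positivity
    have h7 : 0 ≤ B ^ 2 * ‖fderiv ℝ χ (x - p)‖ ^ 2 := by positivity
    simp only [K]
    linarith
  have hint := integrable_sq_and_norm_fderiv_sq
    (volume : Measure (EuclideanSpace ℝ (Fin 2))) hχ hχc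
  calc ∫ x, (‖gradient u x - gradient v x‖ ^ 2 + (u x - v x) ^ 2)
      ≤ ∫ x, K * (χ (x - p) ^ 2 + ‖fderiv ℝ χ (x - p)‖ ^ 2) :=
        integral_mono_of_nonneg (.of_forall fun x => by positivity)
          (((hint.1.add hint.2).comp_sub_right p).const_mul K) (.of_forall hpt)
    _ = K * ∫ x, (χ x ^ 2 + ‖fderiv ℝ χ x‖ ^ 2) := by
        rw [integral_const_mul,
          integral_sub_right_eq_self (fun x => χ x ^ 2 + ‖fderiv ℝ χ x‖ ^ 2) p]
    _ ≤ K * (ε / (K + 1)) := by gcongr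
    _ < ε := by
        rw [mul_div_assoc', div_lt_iff₀ (by positivity)]
        linarith
end
end

section
/- Let Ω be an open subset of ℝ², let p ∈ Ω, and let f : Ω → ℝ be a smooth function. If there exists a smooth function u : ℝ² → ℝ with compact support contained in Ω such that ∫_{Ω} (‖∇u(x)‖² + f(x)·u(x)²) dx < 0, then there exists a smooth function v : ℝ² → ℝ with compact support contained in Ω \ {p} such that ∫_{Ω} (‖∇v(x)‖² + f(x)·v(x)²) dx < 0. -/
open MeasureTheory

noncomputable section

open Set Filter Topology

/-- The derivative of the smooth transition function is bounded on the unit interval. -/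
lemma Real.smoothTransition.exists_abs_deriv_le :
    ∃ C : ℝ, ∀ s ∈ Icc (0 : ℝ) 1, |deriv Real.smoothTransition s| ≤ C := by
  have hcont : Continuous (deriv Real.smoothTransition) :=
    (Real.smoothTransition.contDiff (n := 1)).continuous_deriv le_rfl
  obtain ⟨C, hC⟩ := isCompact_Icc.exists_bound_of_continuousOn
    (hcont.continuousOn (s := Icc (0 : ℝ) 1))
  exact ⟨C, hC⟩

section LogCutoff

variable {F : Type*} [NormedAddCommGroup F]

/-- A smooth logarithmic cutoff at scale `t` around the point `p`. -/
def logCutoff (p : F) (t : ℝ) (x : F) : ℝ :=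
  Real.smoothTransition (2 + Real.log (‖x - p‖ ^ 2 + Real.exp (-(3 * t))) / t)

lemma logCutoff_nonneg (p : F) (t : ℝ) (x : F) : 0 ≤ logCutoff p t x :=
  Real.smoothTransition.nonneg _

lemma logCutoff_le_one (p : F) (t : ℝ) (x : F) : logCutoff p t x ≤ 1 :=
  Real.smoothTransition.le_one _

lemma logCutoff_eq_zero {p : F} {t : ℝ} (ht : 1 ≤ t) {x : F}
    (hx : ‖x - p‖ ^ 2 ≤ Real.exp (-(3 * t))) : logCutoff p t x = 0 := by
  refine Real.smoothTransition.zero_of_nonpos ?_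
  have h2 : 2 * Real.exp (-(3 * t)) ≤ Real.exp (-(2 * t)) := by
    have : Real.exp (-(2 * t)) = Real.exp t * Real.exp (-(3 * t)) := by
      rw [← Real.exp_add]; ring_nf
    rw [this]
    gcongr
    linarith [Real.add_one_le_exp t]
  have hlog : Real.log (‖x - p‖ ^ 2 + Real.exp (-(3 * t))) ≤ -(2 * t) := by
    rw [Real.log_le_iff_le_exp (by positivity)]
    linarith
  have : Real.log (‖x - p‖ ^ 2 + Real.exp (-(3 * t))) / t ≤ -2 := by
    rw [div_le_iff₀ (by linarith)]
    linarith
  linarith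

lemma logCutoff_eq_one {p : F} {t : ℝ} (ht : 1 ≤ t) {x : F}
    (hx : Real.exp (-t) ≤ ‖x - p‖ ^ 2) : logCutoff p t x = 1 := by
  refine Real.smoothTransition.one_of_one_le ?_
  have hlog : -t ≤ Real.log (‖x - p‖ ^ 2 + Real.exp (-(3 * t))) := by
    rw [Real.le_log_iff_exp_le (by positivity)]
    linarith [Real.exp_pos (-(3 * t))]
  have : -1 ≤ Real.log (‖x - p‖ ^ 2 + Real.exp (-(3 * t))) / t := by
    rw [le_div_iff₀ (by linarith)]
    linarith
  linarith

lemma logCutoff_eventuallyEq_zero (p : F) {t : ℝ} (ht : 1 ≤ t) :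
    logCutoff p t =ᶠ[𝓝 p] 0 := by
  have hcont : Continuous fun x : F => ‖x - p‖ ^ 2 := by fun_prop
  have hmem : ∀ᶠ x in 𝓝 p, ‖x - p‖ ^ 2 < Real.exp (-(3 * t)) :=
    hcont.continuousAt.eventually_lt continuousAt_const (by simp [Real.exp_pos])
  filter_upwards [hmem] with x hx using logCutoff_eq_zero ht hx.le

lemma tendsto_logCutoff {p x : F} (hx : x ≠ p) :
    Tendsto (fun n : ℕ => logCutoff p (n : ℝ) x) atTop (𝓝 1) := by
  have hexp : Tendsto (fun n : ℕ => Real.exp (-(n : ℝ))) atTop (𝓝 0) :=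
    Real.tendsto_exp_neg_atTop_nhds_zero.comp tendsto_natCast_atTop_atTop
  have hpos : 0 < ‖x - p‖ ^ 2 := by
    have := norm_pos_iff.2 (sub_ne_zero.2 hx)
    positivity
  refine tendsto_const_nhds.congr' ?_
  filter_upwards [hexp.eventually_le_const hpos, eventually_ge_atTop 1] with n hn hn1
  exact (logCutoff_eq_one (by exact_mod_cast hn1) hn).symm

variable [InnerProductSpace ℝ F]

lemma contDiff_logCutoff (p : F) (t : ℝ) : ContDiff ℝ (⊤ : ℕ∞) (logCutoff p t) := by
  refine Real.smoothTransition.contDiff.comp (contDiff_const.add (ContDiff.div_const ?_ t))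
  refine ContDiff.log ?_ fun x => by positivity
  exact ((contDiff_id.sub contDiff_const).norm_sq ℝ).add contDiff_const

lemma norm_fderiv_logCutoff_sq_le {C : ℝ}
    (hC : ∀ s ∈ Icc (0 : ℝ) 1, |deriv Real.smoothTransition s| ≤ C)
    (p : F) {t : ℝ} (ht : 1 ≤ t) (x : F) :
    ‖fderiv ℝ (logCutoff p t) x‖ ^ 2 ≤
      (Icc (Real.exp (-(3 * t) / 2)) (Real.exp (-t / 2))).indicator
        (fun r => (2 * C / t) ^ 2 * (r ^ 2)⁻¹) ‖x - p‖ := by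
  have hC0 : 0 ≤ C := (abs_nonneg _).trans (hC 0 (by simp))
  have hnonneg : 0 ≤ (Icc (Real.exp (-(3 * t) / 2)) (Real.exp (-t / 2))).indicator
        (fun r => (2 * C / t) ^ 2 * (r ^ 2)⁻¹) ‖x - p‖ :=
    indicator_nonneg (fun r _ => by positivity) _
  have hsq : ∀ a : ℝ, Real.exp (a / 2) ^ 2 = Real.exp a := fun a => by
    rw [← Real.exp_nat_mul]; congr 1; push_cast; ring
  by_cases h0 : logCutoff p t x = 0
  · have hmin : IsLocalMin (logCutoff p t) x :=
      Eventually.of_forall fun y => h0 ▸ logCutoff_nonneg p t y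
    simpa [hmin.fderiv_eq_zero] using hnonneg
  by_cases h1 : logCutoff p t x = 1
  · have hmax : IsLocalMax (logCutoff p t) x :=
      Eventually.of_forall fun y => h1 ▸ logCutoff_le_one p t y
    simpa [hmax.fderiv_eq_zero] using hnonneg
  have hlow : Real.exp (-(3 * t)) < ‖x - p‖ ^ 2 := by
    by_contra! h
    exact h0 (logCutoff_eq_zero ht h)
  have hupp : ‖x - p‖ ^ 2 < Real.exp (-t) := by
    by_contra! h
    exact h1 (logCutoff_eq_one ht h)
  have hmem : ‖x - p‖ ∈ Icc (Real.exp (-(3 * t) / 2)) (Real.exp (-t / 2)) := by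
    constructor
    · refine (sq_le_sq₀ (Real.exp_pos _).le (norm_nonneg _)).1 ?_
      rw [hsq]; exact hlow.le
    · refine (sq_le_sq₀ (norm_nonneg _) (Real.exp_pos _).le).1 ?_
      rw [hsq]; exact hupp.le
  have hr : 0 < ‖x - p‖ := (Real.exp_pos _).trans_le hmem.1
  rw [indicator_of_mem hmem]
  set δ := Real.exp (-(3 * t)) with hδ
  set s := 2 + Real.log (‖x - p‖ ^ 2 + δ) / t with hs
  have hsmem : s ∈ Icc (0 : ℝ) 1 := by
    constructor
    · by_contra! h
      exact h0 (Real.smoothTransition.zero_of_nonpos h.le)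
    · by_contra! h
      exact h1 (Real.smoothTransition.one_of_one_le h.le)
  have hD : 0 < ‖x - p‖ ^ 2 + δ := by positivity
  have hnormsq : HasFDerivAt (fun y : F => ‖y - p‖ ^ 2) (2 • innerSL ℝ (x - p)) x :=
    ((hasFDerivAt_id x).sub_const p).norm_sq
  have hinner : HasFDerivAt (fun y : F => 2 + Real.log (‖y - p‖ ^ 2 + δ) / t)
      (t⁻¹ • ((‖x - p‖ ^ 2 + δ)⁻¹ • (2 • innerSL ℝ (x - p)))) x := by
    simp only [div_eq_inv_mul]
    exact (((hnormsq.add_const δ).log hD.ne').const_mul t⁻¹).const_add 2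
  have hder : HasFDerivAt (logCutoff p t) (deriv Real.smoothTransition s •
      (t⁻¹ • ((‖x - p‖ ^ 2 + δ)⁻¹ • (2 • innerSL ℝ (x - p))))) x :=
    HasDerivAt.comp_hasFDerivAt x
      ((Real.smoothTransition.contDiff (n := 1)).differentiable one_ne_zero s).hasDerivAt hinner
  have ht0 : 0 < t := by linarith
  have hbound : ‖fderiv ℝ (logCutoff p t) x‖ ≤ (2 * C / t) * ‖x - p‖⁻¹ := by
    rw [hder.fderiv, ← Nat.cast_smul_eq_nsmul ℝ]
    simp only [norm_smul, innerSL_apply_norm, norm_inv, Real.norm_eq_abs, Nat.cast_ofNat,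
      abs_of_pos ht0, abs_of_pos hD, abs_two]
    have hfrac : (‖x - p‖ ^ 2 + δ)⁻¹ * ‖x - p‖ ≤ ‖x - p‖⁻¹ := by
      rw [inv_mul_le_iff₀ hD, add_mul, pow_two, mul_assoc, mul_inv_cancel₀ hr.ne', mul_one]
      have : 0 < δ * ‖x - p‖⁻¹ := by positivity
      linarith
    calc |deriv Real.smoothTransition s| * (t⁻¹ * ((‖x - p‖ ^ 2 + δ)⁻¹ * (2 * ‖x - p‖)))
        = |deriv Real.smoothTransition s| * (2 * t⁻¹ * ((‖x - p‖ ^ 2 + δ)⁻¹ * ‖x - p‖)) := by ring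
      _ ≤ C * (2 * t⁻¹ * ‖x - p‖⁻¹) := by
        gcongr
        exact hC s hsmem
      _ = (2 * C / t) * ‖x - p‖⁻¹ := by ring
  calc ‖fderiv ℝ (logCutoff p t) x‖ ^ 2 ≤ ((2 * C / t) * ‖x - p‖⁻¹) ^ 2 := by gcongr
    _ = _ := by rw [mul_pow, inv_pow]

variable [FiniteDimensional ℝ F] [MeasurableSpace F] [BorelSpace F]

lemma integrable_and_integral_indicator_inv_norm_sq (hF : Module.finrank ℝ F = 2)
    {a b : ℝ} (ha : 0 < a) (hab : a ≤ b) (c : ℝ) (p : F) :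
    Integrable (fun x : F => (Icc a b).indicator (fun r => c * (r ^ 2)⁻¹) ‖x - p‖) ∧
      ∫ x : F, (Icc a b).indicator (fun r => c * (r ^ 2)⁻¹) ‖x - p‖ =
        2 * volume.real (Metric.ball (0 : F) 1) * (c * Real.log (b / a)) := by
  have : Nontrivial F := Module.nontrivial_of_finrank_pos (R := ℝ) (by omega)
  set h : ℝ → ℝ := (Icc a b).indicator fun r => c * (r ^ 2)⁻¹ with hh
  have hpt : ∀ y : ℝ, y ^ (Module.finrank ℝ F - 1) • h y =
      (Icc a b).indicator (fun r => c * r⁻¹) y := by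
    intro y
    by_cases hy : y ∈ Icc a b
    · have : y ≠ 0 := (ha.trans_le hy.1).ne'
      simp only [hh, hF, indicator_of_mem hy, smul_eq_mul]
      field_simp
      ring
    · simp [hh, indicator_of_notMem hy]
  have hsub : Icc a b ⊆ Ioi 0 := fun y hy => ha.trans_le hy.1
  have hint : IntegrableOn (fun r : ℝ => c * r⁻¹) (Icc a b) := by
    refine ContinuousOn.integrableOn_Icc (continuousOn_const.mul ?_)
    exact continuousOn_inv₀.mono fun y hy => (hsub hy).ne'
  constructor
  · refine Integrable.comp_sub_right (f := fun x : F => h ‖x‖) ?_ p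
    rw [integrable_fun_norm_addHaar]
    simp only [hpt]
    exact ((integrable_indicator_iff measurableSet_Icc).2 hint).integrableOn
  · rw [integral_sub_right_eq_self (fun x : F => h ‖x‖) p, integral_fun_norm_addHaar]
    simp only [hpt]
    rw [setIntegral_indicator measurableSet_Icc, inter_eq_self_of_subset_right hsub,
      integral_const_mul, integral_Icc_eq_integral_Ioc, ← intervalIntegral.integral_of_le hab,
      integral_inv_of_pos ha (ha.trans_le hab), hF]
    simp [mul_assoc]

lemma integrable_norm_fderiv_logCutoff_sq (hF : Module.finrank ℝ F = 2) (p : F) {t : ℝ}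
    (ht : 1 ≤ t) : Integrable fun x : F => ‖fderiv ℝ (logCutoff p t) x‖ ^ 2 := by
  obtain ⟨C, hC⟩ := Real.smoothTransition.exists_abs_deriv_le
  have hcont : Continuous fun x : F => ‖fderiv ℝ (logCutoff p t) x‖ ^ 2 :=
    ((contDiff_logCutoff p t).continuous_fderiv (by simp)).norm.pow 2
  refine (integrable_and_integral_indicator_inv_norm_sq hF (Real.exp_pos (-(3 * t) / 2))
    (Real.exp_le_exp.2 (by linarith : -(3 * t) / 2 ≤ -t / 2)) ((2 * C / t) ^ 2) p).1.mono'
    hcont.aestronglyMeasurable (Eventually.of_forall fun x => ?_)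
  rw [Real.norm_of_nonneg (by positivity)]
  exact norm_fderiv_logCutoff_sq_le hC p ht x

/-- In dimension two, the Dirichlet energy of the logarithmic cutoffs tends to zero. -/
lemma tendsto_integral_norm_fderiv_logCutoff_sq (hF : Module.finrank ℝ F = 2) (p : F) :
    Tendsto (fun n : ℕ => ∫ x : F, ‖fderiv ℝ (logCutoff p (n : ℝ)) x‖ ^ 2) atTop (𝓝 0) := by
  obtain ⟨C, hC⟩ := Real.smoothTransition.exists_abs_deriv_le
  have hlim : Tendsto (fun n : ℕ => (2 * volume.real (Metric.ball (0 : F) 1) * (2 * C) ^ 2) /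
      (n : ℝ)) atTop (𝓝 0) := tendsto_const_div_atTop_nhds_zero_nat _
  refine squeeze_zero' (Eventually.of_forall fun n => integral_nonneg fun x => by positivity)
    ?_ hlim
  filter_upwards [eventually_ge_atTop 1] with n hn
  have ht : (1 : ℝ) ≤ n := by exact_mod_cast hn
  obtain ⟨hint, heq⟩ := integrable_and_integral_indicator_inv_norm_sq hF
    (Real.exp_pos (-(3 * (n : ℝ)) / 2))
    (Real.exp_le_exp.2 (by linarith : -(3 * (n : ℝ)) / 2 ≤ -(n : ℝ) / 2)) ((2 * C / n) ^ 2) p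
  refine (integral_mono (integrable_norm_fderiv_logCutoff_sq hF p ht) hint
    fun x => norm_fderiv_logCutoff_sq_le hC p ht x).trans_eq ?_
  rw [heq, ← Real.exp_sub, Real.log_exp]
  field_simp
  ring

end LogCutoff

section QuadraticForm

variable {F : Type*} [NormedAddCommGroup F] [InnerProductSpace ℝ F]

lemma norm_gradient_eq_norm_fderiv [CompleteSpace F] (u : F → ℝ) (x : F) :
    ‖gradient u x‖ = ‖fderiv ℝ u x‖ :=
  LinearIsometryEquiv.norm_map _ _

lemma norm_add_sq_le_weighted (a b : F →L[ℝ] ℝ) {ε : ℝ} (hε : 0 < ε) :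
    ‖a + b‖ ^ 2 ≤ (1 + ε) * ‖a‖ ^ 2 + (1 + ε⁻¹) * ‖b‖ ^ 2 := by
  have h1 : ‖a + b‖ ^ 2 ≤ (‖a‖ + ‖b‖) ^ 2 := by gcongr; exact norm_add_le a b
  have h2 : 0 ≤ ε⁻¹ * (ε * ‖a‖ - ‖b‖) ^ 2 := by positivity
  have h3 : ε⁻¹ * (ε * ‖a‖ - ‖b‖) ^ 2 = ε * ‖a‖ ^ 2 - 2 * ‖a‖ * ‖b‖ + ε⁻¹ * ‖b‖ ^ 2 := by
    field_simp
    ring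
  nlinarith

variable [FiniteDimensional ℝ F] [MeasurableSpace F] [BorelSpace F]

lemma integrable_norm_fderiv_sq {u : F → ℝ} (hu : ContDiff ℝ (⊤ : ℕ∞) u)
    (hc : HasCompactSupport u) : Integrable fun x => ‖fderiv ℝ u x‖ ^ 2 := by
  have hcont : Continuous fun x => ‖fderiv ℝ u x‖ ^ 2 :=
    (hu.continuous_fderiv (by simp)).norm.pow 2
  refine hcont.integrable_of_hasCompactSupport ?_
  exact (hc.fderiv ℝ).comp_left (g := fun L : F →L[ℝ] ℝ => ‖L‖ ^ 2) (by simp)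

lemma integrable_mul_sq {Ω : Set F} (hΩ : IsOpen Ω) {f u : F → ℝ} (hf : ContinuousOn f Ω)
    (hu : Continuous u) (hc : HasCompactSupport u) (hsub : tsupport u ⊆ Ω) :
    Integrable fun x => f x * u x ^ 2 := by
  have hc2 : HasCompactSupport fun x => u x ^ 2 :=
    hc.comp_left (g := fun s : ℝ => s ^ 2) (by simp)
  have hsub2 : tsupport (fun x => f x * u x ^ 2) ⊆ Ω := by
    refine (closure_mono fun x hx => ?_).trans hsub
    contrapose! hx
    simp [Function.notMem_support.1 hx]
  have hcont : Continuous fun x => f x * u x ^ 2 :=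
    (hf.mul (hu.pow 2).continuousOn).continuous_of_tsupport_subset hΩ hsub2
  exact hcont.integrable_of_hasCompactSupport hc2.mul_left

end QuadraticForm

/-- If the quadratic form `∫ (‖∇u‖² + f u²)` is negative for some smooth
compactly supported `u` on `Ω`, then it is also negative for some smooth function compactly
supported in `Ω \ {p}` (Euclidean-domain case of Corollary A.5 of the paper). -/
theorem negative_quadratic_form_witness_avoiding_point
    (Ω : Set (EuclideanSpace ℝ (Fin 2))) (hΩ : IsOpen Ω)
    (p : EuclideanSpace ℝ (Fin 2)) (hp : p ∈ Ω)
    (f : EuclideanSpace ℝ (Fin 2) → ℝ) (hf : ContDiffOn ℝ (⊤ : ℕ∞) f Ω)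
    (hexists : ∃ u : EuclideanSpace ℝ (Fin 2) → ℝ,
      ContDiff ℝ (⊤ : ℕ∞) u ∧ HasCompactSupport u ∧ tsupport u ⊆ Ω ∧
      ∫ x in Ω, (‖gradient u x‖ ^ 2 + f x * u x ^ 2) < 0) :
    ∃ v : EuclideanSpace ℝ (Fin 2) → ℝ,
      ContDiff ℝ (⊤ : ℕ∞) v ∧ HasCompactSupport v ∧ tsupport v ⊆ Ω \ {p} ∧
      ∫ x in Ω, (‖gradient v x‖ ^ 2 + f x * v x ^ 2) < 0 := by
  obtain ⟨u, hu, huc, hus, hneg⟩ := hexists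
  simp only [norm_gradient_eq_norm_fderiv] at hneg ⊢
  have hdim : Module.finrank ℝ (EuclideanSpace ℝ (Fin 2)) = 2 := finrank_euclideanSpace_fin
  set Q := ∫ x in Ω, (‖fderiv ℝ u x‖ ^ 2 + f x * u x ^ 2) with hQ
  set B := ∫ x in Ω, ‖fderiv ℝ u x‖ ^ 2 with hB
  have hB0 : 0 ≤ B := integral_nonneg fun x => by positivity
  have hgrad := integrable_norm_fderiv_sq hu huc
  have hform := hgrad.add (integrable_mul_sq hΩ hf.continuousOn hu.continuous huc hus)
  obtain ⟨M, hM⟩ := hu.continuous.bounded_above_of_compact_support huc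
  set ε := -Q / (B + 1) with hε
  have hε0 : 0 < ε := div_pos (by linarith) (by linarith)
  have hlimit_neg : Q + ε * B + (1 + ε⁻¹) * M ^ 2 * 0 < 0 := by
    have : ε * (B + 1) = -Q := div_mul_cancel₀ _ (by linarith)
    linarith
  have hmain : Tendsto (fun n : ℕ => ∫ x in Ω,
      logCutoff p (n : ℝ) x ^ 2 * (‖fderiv ℝ u x‖ ^ 2 + f x * u x ^ 2)) atTop (𝓝 Q) := by
    refine tendsto_integral_of_dominated_convergence
      (fun x => ‖‖fderiv ℝ u x‖ ^ 2 + f x * u x ^ 2‖) (fun n => ?_) hform.norm.restrict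
      (fun n => Eventually.of_forall fun x => ?_) ?_
    · exact ((contDiff_logCutoff p n).continuous.pow 2).aestronglyMeasurable.mul
        hform.restrict.aestronglyMeasurable
    · rw [norm_mul, norm_pow, Real.norm_of_nonneg (logCutoff_nonneg p n x)]
      exact mul_le_of_le_one_left (norm_nonneg _)
        (pow_le_one₀ (logCutoff_nonneg p n x) (logCutoff_le_one p n x))
    · filter_upwards [ae_restrict_of_ae (Measure.ae_ne volume p)] with x hx
      simpa using ((tendsto_logCutoff hx).pow 2).mul_const (‖fderiv ℝ u x‖ ^ 2 + f x * u x ^ 2)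
  have hlim := (hmain.add_const (ε * B)).add
    ((tendsto_integral_norm_fderiv_logCutoff_sq hdim p).const_mul ((1 + ε⁻¹) * M ^ 2))
  obtain ⟨n, hn, hn1⟩ := ((hlim.eventually_lt_const hlimit_neg).and (eventually_ge_atTop 1)).exists
  have ht : (1 : ℝ) ≤ n := by exact_mod_cast hn1
  set φ := logCutoff p (n : ℝ) with hφ
  have hφs : ContDiff ℝ (⊤ : ℕ∞) φ := contDiff_logCutoff p n
  have hvs : ContDiff ℝ (⊤ : ℕ∞) fun x => φ x * u x := hφs.mul hu
  have hvc : HasCompactSupport fun x => φ x * u x := huc.mul_left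
  have hvsub : tsupport (fun x => φ x * u x) ⊆ Ω := tsupport_mul_subset_right.trans hus
  refine ⟨fun x => φ x * u x, hvs, hvc, fun x hx => ⟨hvsub hx, ?_⟩, lt_of_le_of_lt ?_ hn⟩
  · rintro rfl
    refine notMem_tsupport_iff_eventuallyEq.2 ?_ hx
    filter_upwards [logCutoff_eventuallyEq_zero x ht] with y hy
    simp [hφ, hy]
  have hvform := (integrable_norm_fderiv_sq hvs hvc).add
    (integrable_mul_sq hΩ hf.continuousOn hvs.continuous hvc hvsub)
  have hcut : Integrable fun x => ‖fderiv ℝ φ x‖ ^ 2 :=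
    integrable_norm_fderiv_logCutoff_sq hdim p ht
  have hprod : Integrable fun x => φ x ^ 2 * (‖fderiv ℝ u x‖ ^ 2 + f x * u x ^ 2) := by
    refine hform.bdd_mul (c := 1) (hφs.continuous.pow 2).aestronglyMeasurable
      (Eventually.of_forall fun x => ?_)
    rw [Real.norm_of_nonneg (by positivity)]
    exact pow_le_one₀ (logCutoff_nonneg p n x) (logCutoff_le_one p n x)
  have hpt : ∀ x, ‖fderiv ℝ (fun x => φ x * u x) x‖ ^ 2 + f x * (φ x * u x) ^ 2 ≤
      φ x ^ 2 * (‖fderiv ℝ u x‖ ^ 2 + f x * u x ^ 2) + ε * ‖fderiv ℝ u x‖ ^ 2 +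
        (1 + ε⁻¹) * M ^ 2 * ‖fderiv ℝ φ x‖ ^ 2 := by
    intro x
    rw [fderiv_fun_mul (hφs.differentiable (by simp) x) (hu.differentiable (by simp) x)]
    have hadd := norm_add_sq_le_weighted (φ x • fderiv ℝ u x) (u x • fderiv ℝ φ x) hε0
    simp only [norm_smul, mul_pow, Real.norm_eq_abs, sq_abs] at hadd
    have hφ1 : φ x ^ 2 ≤ 1 := pow_le_one₀ (logCutoff_nonneg p n x) (logCutoff_le_one p n x)
    have hu2 : u x ^ 2 ≤ M ^ 2 := by
      rw [← sq_abs]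
      gcongr
      exact hM x
    have h1 : ε * (φ x ^ 2 * ‖fderiv ℝ u x‖ ^ 2) ≤ ε * ‖fderiv ℝ u x‖ ^ 2 := by
      gcongr
      exact mul_le_of_le_one_left (by positivity) hφ1
    have h2 : (1 + ε⁻¹) * (u x ^ 2 * ‖fderiv ℝ φ x‖ ^ 2) ≤
        (1 + ε⁻¹) * (M ^ 2 * ‖fderiv ℝ φ x‖ ^ 2) := by gcongr
    linarith
  have hsum : Integrable fun x => φ x ^ 2 * (‖fderiv ℝ u x‖ ^ 2 + f x * u x ^ 2) +
      ε * ‖fderiv ℝ u x‖ ^ 2 := hprod.add (hgrad.const_mul ε)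
  have hcut' := hcut.const_mul ((1 + ε⁻¹) * M ^ 2)
  calc ∫ x in Ω, (‖fderiv ℝ (fun x => φ x * u x) x‖ ^ 2 + f x * (φ x * u x) ^ 2)
      ≤ ∫ x in Ω, (φ x ^ 2 * (‖fderiv ℝ u x‖ ^ 2 + f x * u x ^ 2) + ε * ‖fderiv ℝ u x‖ ^ 2 +
          (1 + ε⁻¹) * M ^ 2 * ‖fderiv ℝ φ x‖ ^ 2) :=
        integral_mono hvform.restrict (hsum.add hcut').restrict hpt
    _ = (∫ x in Ω, φ x ^ 2 * (‖fderiv ℝ u x‖ ^ 2 + f x * u x ^ 2)) + ε * B +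
          (1 + ε⁻¹) * M ^ 2 * ∫ x in Ω, ‖fderiv ℝ φ x‖ ^ 2 := by
        rw [integral_add hsum.restrict hcut'.restrict,
          integral_add hprod.restrict (hgrad.const_mul ε).restrict, integral_const_mul,
          integral_const_mul]
    _ ≤ _ := by
        have hle := setIntegral_le_integral (s := Ω) hcut
          (Eventually.of_forall fun x => sq_nonneg ‖fderiv ℝ φ x‖)
        have hcoef : 0 ≤ (1 + ε⁻¹) * M ^ 2 := by positivity
        linarith [mul_le_mul_of_nonneg_left hle hcoef]
end
end

section
/- Let D be the open unit disk in ℝ² and let u : ℝ² → ℝ be a smooth function with compact support contained in D. For 0 < ε < 1 define u_ε : ℝ² → ℝ by u_ε(z) = u(z) if ‖z‖ ≥ ε; u_ε(z) = ((ln‖z‖ − ln(ε²)) / ln(1/ε)) · u(z) if ε² ≤ ‖z‖ ≤ ε; and u_ε(z) = 0 if ‖z‖ ≤ ε². Then each u_ε is Lipschitz with compact support contained in D \ {0}, and u_ε converges to u in H¹ as ε → 0⁺: ∫_{ℝ²} (‖∇u_ε(x) − ∇u(x)‖² + (u_ε(x) − u(x))²) dx → 0, where ∇u_ε denotes the almost-everywhere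 defined derivative of the Lipschitz function u_ε. -/
open MeasureTheory Filter

noncomputable section

/-- The logarithmic cutoff `u_ε` of a function `u`, equal to `u` for `‖z‖ ≥ ε`, to
`((ln‖z‖ − ln(ε²)) / ln(1/ε)) · u` for `ε² ≤ ‖z‖ ≤ ε`, and to `0` for `‖z‖ ≤ ε²`. -/
noncomputable def logCutoffOf (ε : ℝ) (u : EuclideanSpace ℝ (Fin 2) → ℝ) :
    EuclideanSpace ℝ (Fin 2) → ℝ := fun z =>
  if ε ≤ ‖z‖ then u z
  else if ε ^ 2 ≤ ‖z‖ then ((Real.log ‖z‖ - Real.log (ε ^ 2)) / Real.log (1 / ε)) * u z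
  else 0

/-- The radial profile of the logarithmic cutoff. -/
noncomputable def logCutoffProfile (ε r : ℝ) : ℝ :=
  min 1 ((Real.log (max r (ε ^ 2)) - Real.log (ε ^ 2)) / Real.log (1 / ε))

lemma log_one_div_pos {ε : ℝ} (h0 : 0 < ε) (h1 : ε < 1) : 0 < Real.log (1 / ε) :=
  Real.log_pos (by rw [lt_div_iff₀ h0]; linarith)

lemma log_sub_log_sq {ε : ℝ} (h0 : 0 < ε) :
    Real.log ε - Real.log (ε ^ 2) = Real.log (1 / ε) := by
  rw [← Real.log_div h0.ne' (by positivity)]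
  congr 1
  field_simp

lemma logCutoffProfile_of_le {ε r : ℝ} (h0 : 0 < ε) (h1 : ε < 1) (hr : ε ≤ r) :
    logCutoffProfile ε r = 1 := by
  have hL := log_one_div_pos h0 h1
  have hr2 : ε ^ 2 ≤ r := by nlinarith
  rw [logCutoffProfile, max_eq_left hr2, min_eq_left]
  rw [le_div_iff₀ hL, one_mul, ← log_sub_log_sq h0]
  gcongr

lemma logCutoffProfile_of_mem {ε r : ℝ} (h0 : 0 < ε) (h1 : ε < 1) (hr2 : ε ^ 2 ≤ r) (hr : r ≤ ε) :
    logCutoffProfile ε r = (Real.log r - Real.log (ε ^ 2)) / Real.log (1 / ε) := by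
  have hL := log_one_div_pos h0 h1
  have hr0 : 0 < r := lt_of_lt_of_le (by positivity) hr2
  rw [logCutoffProfile, max_eq_left hr2, min_eq_right]
  rw [div_le_iff₀ hL, one_mul, ← log_sub_log_sq h0]
  gcongr

lemma logCutoffProfile_of_le_sq {ε r : ℝ} (hr2 : r ≤ ε ^ 2) :
    logCutoffProfile ε r = 0 := by
  rw [logCutoffProfile, max_eq_right hr2]
  simp

lemma logCutoffProfile_mem_Icc {ε : ℝ} (h0 : 0 < ε) (h1 : ε < 1) (r : ℝ) :
    logCutoffProfile ε r ∈ Set.Icc (0 : ℝ) 1 := by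
  have hL := log_one_div_pos h0 h1
  refine ⟨le_min zero_le_one (div_nonneg (sub_nonneg.2 ?_) hL.le), min_le_left _ _⟩
  exact Real.log_le_log (by positivity) (le_max_right _ _)

lemma logCutoffOf_eq {ε : ℝ} (h0 : 0 < ε) (h1 : ε < 1) (u : EuclideanSpace ℝ (Fin 2) → ℝ)
    (z : EuclideanSpace ℝ (Fin 2)) :
    logCutoffOf ε u z = logCutoffProfile ε ‖z‖ * u z := by
  unfold logCutoffOf
  split_ifs with h h'
  · rw [logCutoffProfile_of_le h0 h1 h, one_mul]
  · rw [logCutoffProfile_of_mem h0 h1 h' (not_le.1 h).le]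
  · rw [logCutoffProfile_of_le_sq (not_le.1 h').le, zero_mul]

lemma abs_log_sub_log_le {δ s t : ℝ} (hδ : 0 < δ) (hs : δ ≤ s) (ht : δ ≤ t) :
    |Real.log s - Real.log t| ≤ |s - t| / δ := by
  wlog h : t ≤ s generalizing s t
  · rw [abs_sub_comm, abs_sub_comm s]
    exact this ht hs (not_le.1 h).le
  have ht0 := hδ.trans_le ht
  have hs0 := hδ.trans_le hs
  rw [abs_of_nonneg (sub_nonneg.2 (Real.log_le_log ht0 h)), abs_of_nonneg (sub_nonneg.2 h),
    ← Real.log_div hs0.ne' ht0.ne']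
  calc Real.log (s / t) ≤ s / t - 1 := Real.log_le_sub_one_of_pos (by positivity)
    _ = (s - t) / t := by field_simp
    _ ≤ (s - t) / δ := div_le_div_of_nonneg_left (sub_nonneg.2 h) hδ ht

lemma abs_logCutoffProfile_sub_le {ε : ℝ} (h0 : 0 < ε) (h1 : ε < 1) (r s : ℝ) :
    |logCutoffProfile ε r - logCutoffProfile ε s| ≤ (ε ^ 2 * Real.log (1 / ε))⁻¹ * |r - s| := by
  have hL := log_one_div_pos h0 h1
  have hδ : 0 < ε ^ 2 := by positivity
  unfold logCutoffProfile
  refine (abs_min_sub_min_le_max _ _ _ _).trans ?_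
  rw [sub_self, abs_zero, max_eq_right (abs_nonneg _), ← sub_div, abs_div, abs_of_pos hL,
    sub_sub_sub_cancel_right, div_le_iff₀ hL]
  refine (abs_log_sub_log_le hδ (le_max_right r _) (le_max_right s _)).trans ?_
  rw [div_le_iff₀ hδ]
  refine (abs_max_sub_max_le_max _ _ _ _).trans (le_of_eq ?_)
  rw [sub_self, abs_zero, max_eq_left (abs_nonneg _)]
  field_simp

lemma exists_lipschitzWith_logCutoffOf {ε : ℝ} (h0 : 0 < ε) (h1 : ε < 1)
    {u : EuclideanSpace ℝ (Fin 2) → ℝ} {K : NNReal} (hK : LipschitzWith K u) {M : ℝ}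
    (hM : ∀ x, ‖u x‖ ≤ M) : ∃ K' : NNReal, LipschitzWith K' (logCutoffOf ε u) := by
  have hL := log_one_div_pos h0 h1
  have hM0 : 0 ≤ M := (norm_nonneg _).trans (hM 0)
  set A := (ε ^ 2 * Real.log (1 / ε))⁻¹
  have hA : 0 ≤ A := by positivity
  refine ⟨⟨K + M * A, by positivity⟩, LipschitzWith.of_dist_le_mul fun x y => ?_⟩
  rw [logCutoffOf_eq h0 h1, logCutoffOf_eq h0 h1, Real.dist_eq]
  have hp := logCutoffProfile_mem_Icc h0 h1 ‖x‖
  have hd := abs_logCutoffProfile_sub_le h0 h1 ‖x‖ ‖y‖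
  have hu := hK.dist_le_mul x y
  rw [Real.dist_eq] at hu
  have hn : |‖x‖ - ‖y‖| ≤ dist x y := by rw [dist_eq_norm]; exact abs_norm_sub_norm_le x y
  calc |logCutoffProfile ε ‖x‖ * u x - logCutoffProfile ε ‖y‖ * u y|
      = |logCutoffProfile ε ‖x‖ * (u x - u y)
          + (logCutoffProfile ε ‖x‖ - logCutoffProfile ε ‖y‖) * u y| := by ring_nf
    _ ≤ |logCutoffProfile ε ‖x‖| * |u x - u y|
          + |logCutoffProfile ε ‖x‖ - logCutoffProfile ε ‖y‖| * |u y| := by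
        rw [← abs_mul, ← abs_mul]; exact abs_add_le _ _
    _ ≤ 1 * (K * dist x y) + (A * dist x y) * M := by
        gcongr
        · rw [abs_of_nonneg hp.1]; exact hp.2
        · exact hd.trans (by gcongr)
        · exact hM y
    _ = (K + M * A) * dist x y := by ring

lemma tsupport_logCutoffOf_subset {ε : ℝ} (h0 : 0 < ε) (h1 : ε < 1)
    (u : EuclideanSpace ℝ (Fin 2) → ℝ) :
    tsupport (logCutoffOf ε u) ⊆ tsupport u \ {0} := by
  intro x hx
  refine ⟨closure_mono ?_ hx, ?_⟩
  · intro z hz hz'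
    exact hz (by simp [logCutoffOf_eq h0 h1, hz'])
  · rintro rfl
    refine notMem_tsupport_iff_eventuallyEq.2 ?_ hx
    filter_upwards [Metric.ball_mem_nhds _ (sq_pos_of_pos h0)] with z hz
    rw [mem_ball_zero_iff] at hz
    rw [logCutoffOf_eq h0 h1, logCutoffProfile_of_le_sq hz.le, zero_mul, Pi.zero_apply]

lemma norm_fderiv_log_norm_le {E : Type*} [NormedAddCommGroup E] [InnerProductSpace ℝ E] {x : E}
    (hx : x ≠ 0) :
    DifferentiableAt ℝ (fun z : E => Real.log ‖z‖) x ∧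
      ‖fderiv ℝ (fun z : E => Real.log ‖z‖) x‖ ≤ ‖x‖⁻¹ := by
  have hn : ‖x‖ ≠ 0 := norm_ne_zero_iff.2 hx
  have hd : DifferentiableAt ℝ (fun z : E => ‖z‖) x := differentiableAt_id.norm ℝ hx
  refine ⟨hd.log hn, ?_⟩
  rw [fderiv.log hd hn, norm_smul, norm_inv, norm_norm]
  have h := norm_fderiv_le_of_lipschitz ℝ (f := fun z : E => ‖z‖) (x₀ := x) lipschitzWith_one_norm
  exact mul_le_of_le_one_right (by positivity) (by simpa using h)

/-- A radial function dominating the `H¹` energy density of `u_ε - u`. -/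
noncomputable def logCutoffBound (M ε r : ℝ) : ℝ :=
  (Set.Ioc 0 ε).indicator (fun _ => 3 * M ^ 2) r +
    (Set.Ioc (ε ^ 2) ε).indicator (fun r => 2 * M ^ 2 / Real.log (1 / ε) ^ 2 * (r ^ 2)⁻¹) r

lemma energy_density_le {ε : ℝ} (h0 : 0 < ε) (h1 : ε < 1)
    {u : EuclideanSpace ℝ (Fin 2) → ℝ} (hu : Differentiable ℝ u) {M : ℝ}
    (hM : ∀ x, ‖u x‖ ≤ M) (hM' : ∀ x, ‖fderiv ℝ u x‖ ≤ M) {x : EuclideanSpace ℝ (Fin 2)}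
    (hx0 : ‖x‖ ≠ 0) (hx1 : ‖x‖ ≠ ε ^ 2) (hx2 : ‖x‖ ≠ ε) :
    ‖gradient (logCutoffOf ε u) x - gradient u x‖ ^ 2 + (logCutoffOf ε u x - u x) ^ 2
      ≤ logCutoffBound M ε ‖x‖ := by
  have hL := log_one_div_pos h0 h1
  have hM0 : 0 ≤ M := (norm_nonneg _).trans (hM 0)
  have hxp : 0 < ‖x‖ := lt_of_le_of_ne (norm_nonneg x) hx0.symm
  have hε2 : ε ^ 2 < ε := by nlinarith
  have hux : (u x) ^ 2 ≤ M ^ 2 := by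
    rw [← sq_abs, ← Real.norm_eq_abs]
    gcongr
    exact hM x
  have hgrad : ‖gradient (logCutoffOf ε u) x - gradient u x‖
      = ‖fderiv ℝ (logCutoffOf ε u) x - fderiv ℝ u x‖ := by
    rw [gradient, gradient, ← map_sub, LinearIsometryEquiv.norm_map]
  rw [hgrad]
  rcases lt_or_gt_of_ne hx2 with hlt | hgt
  · rcases lt_or_gt_of_ne hx1 with hlt' | hgt'
    · have hev : logCutoffOf ε u =ᶠ[nhds x] fun _ => 0 := by
        filter_upwards [continuous_norm.continuousAt.eventually_lt_const hlt'] with z hz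
        rw [logCutoffOf_eq h0 h1, logCutoffProfile_of_le_sq hz.le, zero_mul]
      rw [hev.fderiv_eq, hev.eq_of_nhds, logCutoffBound,
        Set.indicator_of_mem (show ‖x‖ ∈ Set.Ioc 0 ε from ⟨hxp, hlt.le⟩),
        Set.indicator_of_notMem (fun h => (h.1.trans hlt').false)]
      have h3 : ‖fderiv ℝ u x‖ ^ 2 ≤ M ^ 2 := by gcongr; exact hM' x
      simp only [fderiv_fun_const, Pi.zero_apply, zero_sub, norm_neg, neg_sq]
      nlinarith
    · have hx : x ≠ 0 := norm_pos_iff.1 hxp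
      obtain ⟨hd, hb⟩ := norm_fderiv_log_norm_le hx
      have hp := logCutoffProfile_mem_Icc h0 h1 ‖x‖
      set c : EuclideanSpace ℝ (Fin 2) → ℝ :=
        fun z => (Real.log ‖z‖ - Real.log (ε ^ 2)) / Real.log (1 / ε) with hc
      have hcx : c x = logCutoffProfile ε ‖x‖ :=
        (logCutoffProfile_of_mem h0 h1 hgt'.le hlt.le).symm
      have hev : logCutoffOf ε u =ᶠ[nhds x] fun z => c z * u z := by
        filter_upwards [continuous_norm.continuousAt.eventually_lt_const hlt,
          continuous_norm.continuousAt.eventually_const_lt hgt'] with z hz hz'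
        rw [logCutoffOf_eq h0 h1, logCutoffProfile_of_mem h0 h1 hz'.le hz.le]
      have hcd : HasFDerivAt c ((Real.log (1 / ε))⁻¹ • fderiv ℝ (fun z => Real.log ‖z‖) x) x := by
        simp only [hc, div_eq_inv_mul]
        exact (hd.hasFDerivAt.sub_const _).const_mul _
      have hcu : fderiv ℝ (fun z => c z * u z) x = _ := (hcd.mul (hu x).hasFDerivAt).fderiv
      rw [hev.fderiv_eq, hev.eq_of_nhds, hcu, logCutoffBound,
        Set.indicator_of_mem (show ‖x‖ ∈ Set.Ioc 0 ε from ⟨hxp, hlt.le⟩),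
        Set.indicator_of_mem (show ‖x‖ ∈ Set.Ioc (ε ^ 2) ε from ⟨hgt', hlt.le⟩), hcx]
      set p := logCutoffProfile ε ‖x‖
      set L := Real.log (1 / ε)
      have h1p : |p - 1| ≤ 1 := by rw [abs_le]; constructor <;> linarith [hp.1, hp.2]
      have hnorm : ‖p • fderiv ℝ u x + u x • (L⁻¹ • fderiv ℝ (fun z => Real.log ‖z‖) x)
          - fderiv ℝ u x‖ ≤ M + M * (L⁻¹ * ‖x‖⁻¹) := by
        calc _ = ‖(p - 1) • fderiv ℝ u x + u x • (L⁻¹ • fderiv ℝ (fun z => Real.log ‖z‖) x)‖ := by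
              congr 1; rw [sub_smul, one_smul]; abel
          _ ≤ ‖(p - 1) • fderiv ℝ u x‖
              + ‖u x • (L⁻¹ • fderiv ℝ (fun z => Real.log ‖z‖) x)‖ := norm_add_le _ _
          _ ≤ 1 * M + M * (L⁻¹ * ‖x‖⁻¹) := by
              rw [norm_smul, norm_smul, norm_smul, Real.norm_eq_abs (p - 1), norm_inv,
                Real.norm_of_nonneg hL.le]
              gcongr
              exacts [hM' x, hM x]
          _ = _ := by rw [one_mul]
      have hsq := pow_le_pow_left₀ (norm_nonneg _) hnorm 2
      have hz : (p * u x - u x) ^ 2 ≤ M ^ 2 := by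
        have : (p - 1) ^ 2 ≤ 1 := by rw [← sq_abs]; exact pow_le_one₀ (abs_nonneg _) h1p
        calc (p * u x - u x) ^ 2 = (p - 1) ^ 2 * u x ^ 2 := by ring
          _ ≤ 1 * M ^ 2 := by gcongr
          _ = _ := one_mul _
      have hrw : 2 * M ^ 2 / L ^ 2 * (‖x‖ ^ 2)⁻¹ = 2 * (M * (L⁻¹ * ‖x‖⁻¹)) ^ 2 := by
        field_simp
      rw [hrw]
      nlinarith [sq_nonneg (M - M * (L⁻¹ * ‖x‖⁻¹))]
  · have hev : logCutoffOf ε u =ᶠ[nhds x] u := by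
      filter_upwards [continuous_norm.continuousAt.eventually_const_lt hgt] with z hz
      rw [logCutoffOf_eq h0 h1, logCutoffProfile_of_le h0 h1 hz.le, one_mul]
    rw [hev.fderiv_eq, hev.eq_of_nhds, logCutoffBound,
      Set.indicator_of_notMem (fun h => (h.2.trans_lt hgt).false),
      Set.indicator_of_notMem (fun h => (h.2.trans_lt hgt).false)]
    simp

lemma integral_logCutoffBound (M : ℝ) {ε : ℝ} (h0 : 0 < ε) (h1 : ε < 1) :
    IntegrableOn (fun y => y * logCutoffBound M ε y) (Set.Ioi 0) ∧
      ∫ y in Set.Ioi 0, y * logCutoffBound M ε y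
        = 3 * M ^ 2 * (ε ^ 2 / 2) + 2 * M ^ 2 / Real.log (1 / ε) := by
  have hL := log_one_div_pos h0 h1
  have hε2 : ε ^ 2 ≤ ε := by nlinarith
  have hδ : 0 < ε ^ 2 := by positivity
  set c := 2 * M ^ 2 / Real.log (1 / ε) ^ 2 with hc
  have heq : (fun y => y * logCutoffBound M ε y) =
      fun y => (Set.Ioc 0 ε).indicator (fun y => 3 * M ^ 2 * y) y +
        (Set.Ioc (ε ^ 2) ε).indicator (fun y => c * y⁻¹) y := by
    funext y
    rw [logCutoffBound, mul_add]
    congr 1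
    · simp only [Set.indicator_apply, ite_mul, zero_mul, mul_comm y]
    · simp only [Set.indicator_apply, mul_ite, mul_zero]
      rcases eq_or_ne y 0 with rfl | hy
      · simp
      · congr 1
        rw [hc]
        field_simp
  have hi1 : IntegrableOn (fun y : ℝ => 3 * M ^ 2 * y) (Set.Ioc 0 ε) :=
    (Continuous.integrableOn_Icc (by fun_prop)).mono_set Set.Ioc_subset_Icc_self
  have hi2 : IntegrableOn (fun y : ℝ => c * y⁻¹) (Set.Ioc (ε ^ 2) ε) := by
    refine (ContinuousOn.integrableOn_Icc ?_).mono_set Set.Ioc_subset_Icc_self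
    exact continuousOn_const.mul (continuousOn_inv₀.mono fun y hy => (hδ.trans_le hy.1).ne')
  have hI1 := (hi1.integrable_indicator measurableSet_Ioc).integrableOn (s := Set.Ioi 0)
  have hI2 := (hi2.integrable_indicator measurableSet_Ioc).integrableOn (s := Set.Ioi 0)
  have hs1 : Set.Ioi 0 ∩ Set.Ioc 0 ε = Set.Ioc 0 ε :=
    Set.inter_eq_right.2 fun y hy => hy.1
  have hs2 : Set.Ioi 0 ∩ Set.Ioc (ε ^ 2) ε = Set.Ioc (ε ^ 2) ε :=
    Set.inter_eq_right.2 fun y hy => hδ.trans hy.1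
  rw [heq]
  refine ⟨hI1.add hI2, ?_⟩
  rw [integral_add hI1 hI2, setIntegral_indicator measurableSet_Ioc,
    setIntegral_indicator measurableSet_Ioc, hs1, hs2,
    ← intervalIntegral.integral_of_le h0.le, ← intervalIntegral.integral_of_le hε2,
    intervalIntegral.integral_const_mul, intervalIntegral.integral_const_mul,
    integral_id, integral_inv_of_pos hδ h0, Real.log_div h0.ne' hδ.ne', log_sub_log_sq h0, hc]
  field_simp
  ring

lemma tendsto_logCutoffBound (M V : ℝ) :
    Tendsto (fun ε : ℝ => 2 * (V * (3 * M ^ 2 * (ε ^ 2 / 2) + 2 * M ^ 2 / Real.log (1 / ε))))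
      (nhdsWithin 0 (Set.Ioo (0 : ℝ) 1)) (nhds 0) := by
  have hle : nhdsWithin (0 : ℝ) (Set.Ioo (0 : ℝ) 1) ≤ nhdsWithin 0 (Set.Ioi 0) :=
    nhdsWithin_mono _ Set.Ioo_subset_Ioi_self
  have hL : Tendsto (fun ε : ℝ => Real.log (1 / ε)) (nhdsWithin 0 (Set.Ioo (0 : ℝ) 1)) atTop := by
    simp only [one_div]
    exact Real.tendsto_log_atTop.comp (tendsto_inv_nhdsGT_zero.mono_left hle)
  have h2 : Tendsto (fun ε : ℝ => 3 * M ^ 2 * (ε ^ 2 / 2)) (nhdsWithin 0 (Set.Ioo (0 : ℝ) 1))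
      (nhds 0) := by
    have : Continuous fun ε : ℝ => 3 * M ^ 2 * (ε ^ 2 / 2) := by fun_prop
    simpa using (this.tendsto 0).mono_left nhdsWithin_le_nhds
  simpa using ((h2.add (hL.const_div_atTop (2 * M ^ 2))).const_mul V).const_mul 2

/-- For `u` smooth with compact support in the open unit disk `D`, the cutoffs
`u_ε` are Lipschitz with compact support in `D \ {0}` and converge to `u` in `H¹` as `ε → 0⁺`.
(Here `gradient` is the almost-everywhere defined derivative of the Lipschitz function `u_ε`.) -/
theorem logCutoff_tendsto_H1
    (u : EuclideanSpace ℝ (Fin 2) → ℝ) (hu : ContDiff ℝ (⊤ : ℕ∞) u)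
    (hcs : HasCompactSupport u)
    (hsupp : tsupport u ⊆ Metric.ball (0 : EuclideanSpace ℝ (Fin 2)) 1) :
    (∀ ε : ℝ, 0 < ε → ε < 1 →
      (∃ K : NNReal, LipschitzWith K (logCutoffOf ε u)) ∧
      HasCompactSupport (logCutoffOf ε u) ∧
      tsupport (logCutoffOf ε u) ⊆
        Metric.ball (0 : EuclideanSpace ℝ (Fin 2)) 1 \ {0}) ∧
    Tendsto
      (fun ε : ℝ =>
        ∫ x, (‖gradient (logCutoffOf ε u) x - gradient u x‖ ^ 2
              + (logCutoffOf ε u x - u x) ^ 2))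
      (nhdsWithin 0 (Set.Ioo (0 : ℝ) 1)) (nhds 0) := by
  obtain ⟨M₁, hM₁⟩ := hcs.exists_bound_of_continuous hu.continuous
  obtain ⟨M₂, hM₂⟩ := (hcs.fderiv (𝕜 := ℝ)).exists_bound_of_continuous
    (hu.continuous_fderiv (by simp))
  have hd : Differentiable ℝ u := hu.differentiable (by simp)
  set M := max M₁ M₂
  have hM : ∀ x, ‖u x‖ ≤ M := fun x => (hM₁ x).trans (le_max_left _ _)
  have hM' : ∀ x, ‖fderiv ℝ u x‖ ≤ M := fun x => (hM₂ x).trans (le_max_right _ _)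
  refine ⟨fun ε h0 h1 => ?_, ?_⟩
  · have hK : LipschitzWith M.toNNReal u :=
      lipschitzWith_of_nnnorm_fderiv_le hd fun x => by
        rw [← NNReal.coe_le_coe, coe_nnnorm]
        exact (hM' x).trans (Real.le_coe_toNNReal M)
    have hsub := tsupport_logCutoffOf_subset h0 h1 u
    refine ⟨exists_lipschitzWith_logCutoffOf h0 h1 hK hM, ?_,
      hsub.trans (Set.sdiff_subset_sdiff_left hsupp)⟩
    exact hcs.of_isClosed_subset (isClosed_tsupport _) (hsub.trans Set.sdiff_subset)
  · refine squeeze_zero' (Eventually.of_forall fun ε => integral_nonneg fun x => by positivity) ?_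
      (tendsto_logCutoffBound M
        ((volume : Measure (EuclideanSpace ℝ (Fin 2))).real (Metric.ball 0 1)))
    filter_upwards [self_mem_nhdsWithin] with ε hε
    obtain ⟨h0, h1⟩ := hε
    obtain ⟨hint, hval⟩ := integral_logCutoffBound M h0 h1
    have hnorm := integral_fun_norm_addHaar (volume : Measure (EuclideanSpace ℝ (Fin 2)))
      (logCutoffBound M ε)
    have hintg := (integrable_fun_norm_addHaar (volume : Measure (EuclideanSpace ℝ (Fin 2)))
      (f := logCutoffBound M ε)).2 (by simpa using hint)
    simp only [finrank_euclideanSpace_fin, Nat.add_one_sub_one, pow_one, smul_eq_mul, hval,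
      nsmul_eq_mul, Nat.cast_ofNat] at hnorm
    rw [← hnorm]
    have hne : ∀ r : ℝ, ∀ᵐ x : EuclideanSpace ℝ (Fin 2), ‖x‖ ≠ r := fun r => by
      have := Measure.addHaar_sphere (volume : Measure (EuclideanSpace ℝ (Fin 2))) 0 r
      rw [ae_iff]
      convert this using 2
      ext x
      simp
    refine integral_mono_of_nonneg (Eventually.of_forall fun x => by positivity) hintg ?_
    filter_upwards [hne 0, hne (ε ^ 2), hne ε] with x hx0 hx1 hx2
    exact energy_density_le h0 h1 hd hM hM' hx0 hx1 hx2
end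
end
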